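/- arXiv:1606.02197 — 2 statements merged into one kernel-verified Lean document; each statement's English description precedes it below -/
import Mathlib

section
/- For 0 < κ ≤ 1 and a unit vector ĉ = (c₁,c₂,c₃) ∈ ℝ³, define A(κ,ĉ) := ∫_{S²} ∫_{S²} Ibin(κ·(c₁n₁m₁ + c₂n₂m₂ + c₃n₃m₃)) dμ(n) dμ(m). Then for every 0 < κ ≤ 1 and every unit vector ĉ, A(κ, (1,1,1)/√3) ≤ A(κ, ĉ) ≤ A(κ, (0,0,1)); that is, at fixed κ ≤ 1 the average mutual information is minimal for the isotropic direction and maximal for the direction with a single nonzero component. -/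
open MeasureTheory Matrix

/-- Euclidean norm of a vector in ℝ³. -/
noncomputable def enorm3 (v : Fin 3 → ℝ) : ℝ := Real.sqrt (v 0 ^ 2 + v 1 ^ 2 + v 2 ^ 2)

/-- Euclidean inner product on ℝ³. -/
def dot3 (v w : Fin 3 → ℝ) : ℝ := v 0 * w 0 + v 1 * w 1 + v 2 * w 2

/-- `μ` is the uniform (rotation-invariant) probability measure on the unit sphere
`S² = {v ∈ ℝ³ : |v| = 1}`: it is a probability measure, it gives full measure to the
sphere, and it is invariant under every orthogonal transformation of ℝ³. -/
def IsUniformSphereMeasure (μ : Measure (Fin 3 → ℝ)) : Prop :=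
  IsProbabilityMeasure μ ∧
  μ {v | v 0 ^ 2 + v 1 ^ 2 + v 2 ^ 2 ≠ 1} = 0 ∧
  ∀ O : Matrix (Fin 3) (Fin 3) ℝ, O * Oᵀ = 1 → μ.map (Matrix.mulVec O) = μ


/-- The binary mutual information `Ibin(x) = ((1+x)·log₂(1+x) + (1−x)·log₂(1−x))/2`. -/
noncomputable def Ibin (x : ℝ) : ℝ :=
  ((1 + x) * Real.logb 2 (1 + x) + (1 - x) * Real.logb 2 (1 - x)) / 2

/-- The average mutual information `⟨I⟩_Ω(κ,ĉ)` of the MMMS with correlation vector `κ·ĉ`,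
averaged over all pairs of local observables (i.e. over both Bloch spheres). -/
noncomputable def avgMI (μ : Measure (Fin 3 → ℝ)) (κ : ℝ) (c : Fin 3 → ℝ) : ℝ :=
  ∫ m, ∫ n, Ibin (κ * (c 0 * n 0 * m 0 + c 1 * n 1 * m 1 + c 2 * n 2 * m 2)) ∂μ ∂μ

noncomputable def FF (s : ℝ) : ℝ := Ibin (Real.sqrt s)

lemma Ibin_eq (x : ℝ) : Ibin x =
    ((1 + x) * Real.log (1 + x) + (1 - x) * Real.log (1 - x)) / (2 * Real.log 2) := by
  have h : Real.log 2 ≠ 0 := (Real.log_pos (by norm_num)).ne'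
  unfold Ibin Real.logb
  field_simp

lemma Ibin_cont : Continuous Ibin := by
  have h : Ibin = fun x => ((1 + x) * Real.log (1 + x) + (1 - x) * Real.log (1 - x)) /
      (2 * Real.log 2) := funext Ibin_eq
  rw [h]
  have h1 : Continuous fun x : ℝ => (1 + x) * Real.log (1 + x) :=
    Real.continuous_mul_log.comp (continuous_const.add continuous_id)
  have h2 : Continuous fun x : ℝ => (1 - x) * Real.log (1 - x) :=
    Real.continuous_mul_log.comp (continuous_const.sub continuous_id)
  exact (h1.add h2).div_const _

lemma FF_cont : Continuous FF := Ibin_cont.comp Real.continuous_sqrt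

lemma Ibin_neg (x : ℝ) : Ibin (-x) = Ibin x := by
  unfold Ibin
  rw [sub_neg_eq_add, ← sub_eq_add_neg]; ring

lemma FF_sq (x : ℝ) : FF (x ^ 2) = Ibin x := by
  unfold FF
  rw [Real.sqrt_sq_eq_abs]
  rcases abs_choice x with h | h <;> rw [h]
  exact Ibin_neg x

lemma Ibin_deriv (x : ℝ) (h0 : 0 < x) (h1 : x < 1) :
    HasDerivAt Ibin ((Real.log (1 + x) - Real.log (1 - x)) / (2 * Real.log 2)) x := by
  have h : Ibin = fun x => ((1 + x) * Real.log (1 + x) + (1 - x) * Real.log (1 - x)) /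
      (2 * Real.log 2) := funext Ibin_eq
  rw [h]
  have e1 : (1 + x) ≠ 0 := by linarith
  have e2 : (1 - x) ≠ 0 := by linarith
  have a1 : HasDerivAt (fun x : ℝ => 1 + x) 1 x := (hasDerivAt_id x).const_add 1
  have a2 : HasDerivAt (fun x : ℝ => 1 - x) (-1) x := (hasDerivAt_id x).const_sub 1
  have b1 := a1.mul (a1.log e1)
  have b2 := a2.mul (a2.log e2)
  have := (b1.add b2).div_const (2 * Real.log 2)
  refine this.congr_deriv ?_
  congr 1
  field_simp
  ring

lemma FF_deriv (s : ℝ) (h0 : 0 < s) (h1 : s < 1) :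
    HasDerivAt FF ((Real.log (1 + √s) - Real.log (1 - √s)) / (2 * Real.log 2) * (1 / (2 * √s))) s := by
  have hs : 0 < √s := Real.sqrt_pos.2 h0
  have hs1 : √s < 1 := by rw [Real.sqrt_lt' one_pos]; simpa using h1
  exact (Ibin_deriv (√s) hs hs1).comp s (Real.hasDerivAt_sqrt h0.ne')

lemma key_mono (x y : ℝ) (h0 : 0 < x) (hxy : x ≤ y) (h1 : y < 1) :
    (Real.log (1 + x) - Real.log (1 - x)) * (1 / x) ≤
      (Real.log (1 + y) - Real.log (1 - y)) * (1 / y) := by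
  have hx := (Real.hasSum_log_sub_log_of_abs_lt_one (x := x)
    (by rw [abs_lt]; constructor <;> linarith)).mul_right (1 / x)
  have hy := (Real.hasSum_log_sub_log_of_abs_lt_one (x := y)
    (by rw [abs_lt]; constructor <;> linarith)).mul_right (1 / y)
  refine hasSum_le (fun k => ?_) hx hy
  have hy0 : 0 < y := by linarith
  have e : ∀ z : ℝ, 0 < z → (2:ℝ) * (1 / (2 * k + 1)) * z ^ (2 * k + 1) * (1 / z) =
      (2:ℝ) * (1 / (2 * k + 1)) * z ^ (2 * k) := by
    intro z hz
    rw [pow_succ]; field_simp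
  rw [e x h0, e y hy0]
  gcongr

lemma FF_convex : ConvexOn ℝ (Set.Icc 0 1) FF := by
  apply MonotoneOn.convexOn_of_deriv (convex_Icc 0 1) FF_cont.continuousOn
  · rw [interior_Icc]
    intro s hs
    exact (FF_deriv s hs.1 hs.2).differentiableAt.differentiableWithinAt
  · rw [interior_Icc]
    intro s hs t ht hst
    rw [(FF_deriv s hs.1 hs.2).deriv, (FF_deriv t ht.1 ht.2).deriv]
    have hl : 0 < Real.log 2 := Real.log_pos (by norm_num)
    have := key_mono (√s) (√t) (Real.sqrt_pos.2 hs.1) (Real.sqrt_le_sqrt hst)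
      (by rw [Real.sqrt_lt' one_pos]; simpa using ht.2)
    have e : ∀ a z : ℝ, a / (2 * Real.log 2) * (1 / (2 * z)) = (a * (1 / z)) / (4 * Real.log 2) := by
      intro a z
      rw [show 4 * Real.log 2 = (2 * Real.log 2) * 2 by ring]
      simp only [div_eq_mul_inv, mul_inv]; ring
    rw [e, e]
    gcongr

lemma FF_jensen (a b c x y z : ℝ) (ha : 0 ≤ a) (hb : 0 ≤ b) (hc : 0 ≤ c) (h : a + b + c = 1)
    (hx : x ∈ Set.Icc (0:ℝ) 1) (hy : y ∈ Set.Icc (0:ℝ) 1) (hz : z ∈ Set.Icc (0:ℝ) 1) :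
    FF (a * x + b * y + c * z) ≤ a * FF x + b * FF y + c * FF z := by
  have := FF_convex.map_sum_le (t := Finset.univ) (w := ![a, b, c]) (p := ![x, y, z])
    (by intro i _; fin_cases i <;> simpa) (by simp [Fin.sum_univ_three, h])
    (by intro i _; fin_cases i <;> simpa)
  simpa [Fin.sum_univ_three] using this

lemma int_rot (μ : Measure (Fin 3 → ℝ)) (hμ : IsUniformSphereMeasure μ)
    (O : Matrix (Fin 3) (Fin 3) ℝ) (hO : O * Oᵀ = 1) (f : (Fin 3 → ℝ) → ℝ)
    (hf : StronglyMeasurable f) : ∫ n, f n ∂μ = ∫ n, f (O *ᵥ n) ∂μ := by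
  have h := hμ.2.2 O hO
  conv_lhs => rw [← h]
  have hc : Continuous (fun n : Fin 3 → ℝ => O *ᵥ n) := continuous_const.matrix_mulVec continuous_id
  exact integral_map hc.aemeasurable hf.aestronglyMeasurable

lemma rot_v (μ : Measure (Fin 3 → ℝ)) (hμ : IsUniformSphereMeasure μ) (f : ℝ → ℝ)
    (hf : Continuous f) (v : Fin 3 → ℝ) :
    ∫ n, f (v 0 * n 0 + v 1 * n 1 + v 2 * n 2) ∂μ =
      ∫ n, f (√(v 0 ^ 2 + v 1 ^ 2 + v 2 ^ 2) * n 2) ∂μ := by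
  set r := √(v 0 ^ 2 + v 1 ^ 2 + v 2 ^ 2) with hr
  have hr2 : r ^ 2 = v 0 ^ 2 + v 1 ^ 2 + v 2 ^ 2 := Real.sq_sqrt (by positivity)
  clear_value r
  by_cases hw : v 0 ^ 2 + v 1 ^ 2 + (v 2 - r) ^ 2 = 0
  · have h0 : v 0 = 0 := by nlinarith [sq_nonneg (v 0), sq_nonneg (v 1), sq_nonneg (v 2 - r)]
    have h1 : v 1 = 0 := by nlinarith [sq_nonneg (v 0), sq_nonneg (v 1), sq_nonneg (v 2 - r)]
    have h2 : v 2 - r = 0 := by nlinarith [sq_nonneg (v 0), sq_nonneg (v 1), sq_nonneg (v 2 - r)]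
    have h2' : v 2 = r := by linarith
    simp [h0, h1, h2']
  · obtain ⟨t, ht⟩ : ∃ t : ℝ, t * (v 0 ^ 2 + v 1 ^ 2 + (v 2 - r) ^ 2) = 2 :=
      ⟨2 / _, div_mul_cancel₀ _ hw⟩
    obtain ⟨z, hz⟩ : ∃ z, v 2 = z + r := ⟨v 2 - r, by ring⟩
    rw [hz] at hr2 hw ht ⊢
    rw [add_sub_cancel_right] at ht hw
    clear hr hz
    generalize v 0 = x at *
    generalize v 1 = y at *
    rw [int_rot μ hμ !![1 - t * x * x, - t * x * y, - t * x * z;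
      - t * y * x, 1 - t * y * y, - t * y * z;
      - t * z * x, - t * z * y, 1 - t * z * z] ?_ _ ?_]
    · congr 1
      ext n
      congr 1
      simp [Matrix.mulVec, dotProduct, Fin.sum_univ_three]
      have : t * (x ^ 2 + y ^ 2 + z * (z + r)) = 1 := by
        have : x ^ 2 + y ^ 2 + z * (z + r) = (x ^ 2 + y ^ 2 + z ^ 2) / 2 := by nlinarith
        rw [this]; linarith
      linear_combination (-(x * n 0 + y * n 1 + z * n 2)) * this
    · ext i j
      fin_cases i <;> fin_cases j <;> simp [Matrix.mul_apply, Fin.sum_univ_three]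
      · linear_combination t * x * x * ht
      · linear_combination t * x * y * ht
      · linear_combination t * x * z * ht
      · linear_combination t * x * y * ht
      · linear_combination t * y * y * ht
      · linear_combination t * y * z * ht
      · linear_combination t * x * z * ht
      · linear_combination t * y * z * ht
      · linear_combination t * z * z * ht
    · have : Continuous fun n : Fin 3 → ℝ => f (x * n 0 + y * n 1 + (z + r) * n 2) := by fun_prop
      exact this.stronglyMeasurable

noncomputable def KK (κ a b c : ℝ) (z : (Fin 3 → ℝ) × (Fin 3 → ℝ)) : ℝ :=
  FF (κ ^ 2 * (a * z.1 0 ^ 2 + b * z.1 1 ^ 2 + c * z.1 2 ^ 2) * z.2 2 ^ 2)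

noncomputable def JJ (μ : Measure (Fin 3 → ℝ)) (κ a b c : ℝ) : ℝ :=
  ∫ m, ∫ n, KK κ a b c (m, n) ∂μ ∂μ

lemma KK_cont (κ a b c : ℝ) : Continuous (KK κ a b c) := by
  unfold KK
  exact FF_cont.comp (by fun_prop)

lemma avg_eq (μ : Measure (Fin 3 → ℝ)) (hμ : IsUniformSphereMeasure μ) (κ : ℝ)
    (c : Fin 3 → ℝ) : avgMI μ κ c = JJ μ κ (c 0 ^ 2) (c 1 ^ 2) (c 2 ^ 2) := by
  unfold avgMI JJ
  congr 1
  ext m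
  have h := rot_v μ hμ (fun x => Ibin (κ * x)) (Ibin_cont.comp (by fun_prop))
    ![c 0 * m 0, c 1 * m 1, c 2 * m 2]
  simp only [Matrix.cons_val] at h
  convert h using 1
  · congr 1; ext n; congr 1; ring
  · congr 1; ext n
    unfold KK
    rw [← FF_sq]
    congr 1
    rw [mul_pow, mul_pow, Real.sq_sqrt (by positivity)]
    ring

lemma JJ_cyc (μ : Measure (Fin 3 → ℝ)) (hμ : IsUniformSphereMeasure μ) (κ a b c : ℝ) :
    JJ μ κ a b c = JJ μ κ b c a := by
  have := hμ.1
  unfold JJ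
  rw [int_rot μ hμ !![0, 0, 1; 1, 0, 0; 0, 1, 0] ?_ _ ?_]
  · congr 1; ext m; congr 1; ext n
    simp [KK, Matrix.mulVec, dotProduct, Fin.sum_univ_three]
    congr 1; ring
  · ext i j
    fin_cases i <;> fin_cases j <;> simp [Matrix.mul_apply, Fin.sum_univ_three]
  · exact (KK_cont κ a b c).stronglyMeasurable.integral_prod_right'

lemma comb_mem (a b c x y z : ℝ) (ha : 0 ≤ a) (hb : 0 ≤ b) (hc : 0 ≤ c) (h : a + b + c = 1)
    (hs : x ^ 2 + y ^ 2 + z ^ 2 = 1) : a * x ^ 2 + b * y ^ 2 + c * z ^ 2 ∈ Set.Icc (0:ℝ) 1 := by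
  constructor
  · positivity
  · nlinarith [mul_nonneg ha (sq_nonneg y), mul_nonneg ha (sq_nonneg z),
      mul_nonneg hb (sq_nonneg x), mul_nonneg hb (sq_nonneg z),
      mul_nonneg hc (sq_nonneg x), mul_nonneg hc (sq_nonneg y)]

lemma arg_mem (κ a b c : ℝ) (hκ0 : 0 < κ) (hκ1 : κ ≤ 1) (ha : 0 ≤ a) (hb : 0 ≤ b) (hc : 0 ≤ c)
    (h : a + b + c = 1) (m n : Fin 3 → ℝ) (hm : m 0 ^ 2 + m 1 ^ 2 + m 2 ^ 2 = 1)
    (hn : n 0 ^ 2 + n 1 ^ 2 + n 2 ^ 2 = 1) :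
    κ ^ 2 * (a * m 0 ^ 2 + b * m 1 ^ 2 + c * m 2 ^ 2) * n 2 ^ 2 ∈ Set.Icc (0:ℝ) 1 := by
  have h1 := comb_mem a b c _ _ _ ha hb hc h hm
  have h2 : n 2 ^ 2 ≤ 1 := by nlinarith [sq_nonneg (n 0), sq_nonneg (n 1)]
  have h3 : κ ^ 2 ≤ 1 := pow_le_one₀ hκ0.le hκ1
  refine ⟨mul_nonneg (mul_nonneg (sq_nonneg _) h1.1) (sq_nonneg _), ?_⟩
  exact mul_le_one₀ (mul_le_one₀ h3 h1.1 h1.2) (sq_nonneg _) h2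

lemma ae_sph (μ : Measure (Fin 3 → ℝ)) (hμ : IsUniformSphereMeasure μ) :
    ∀ᵐ z ∂(μ.prod μ), (z.1 0 ^ 2 + z.1 1 ^ 2 + z.1 2 ^ 2 = 1) ∧
      (z.2 0 ^ 2 + z.2 1 ^ 2 + z.2 2 ^ 2 = 1) := by
  have := hμ.1
  have h : ∀ᵐ v ∂μ, v 0 ^ 2 + v 1 ^ 2 + v 2 ^ 2 = 1 := by
    rw [ae_iff]; exact hμ.2.1
  exact (Measure.quasiMeasurePreserving_fst.ae h).and (Measure.quasiMeasurePreserving_snd.ae h)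

lemma KK_int (μ : Measure (Fin 3 → ℝ)) (hμ : IsUniformSphereMeasure μ) (κ a b c : ℝ)
    (hκ0 : 0 < κ) (hκ1 : κ ≤ 1) (ha : 0 ≤ a) (hb : 0 ≤ b) (hc : 0 ≤ c) (h : a + b + c = 1) :
    Integrable (KK κ a b c) (μ.prod μ) := by
  have := hμ.1
  obtain ⟨C, hC⟩ := (isCompact_Icc (a := (0:ℝ)) (b := 1)).exists_bound_of_continuousOn
    FF_cont.continuousOn
  refine Integrable.of_bound (KK_cont κ a b c).aestronglyMeasurable C ?_
  filter_upwards [ae_sph μ hμ] with z hz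
  exact hC _ (arg_mem κ a b c hκ0 hκ1 ha hb hc h _ _ hz.1 hz.2)

lemma JJ_eq (μ : Measure (Fin 3 → ℝ)) (hμ : IsUniformSphereMeasure μ) (κ a b c : ℝ)
    (hκ0 : 0 < κ) (hκ1 : κ ≤ 1) (ha : 0 ≤ a) (hb : 0 ≤ b) (hc : 0 ≤ c) (h : a + b + c = 1) :
    JJ μ κ a b c = ∫ z, KK κ a b c z ∂(μ.prod μ) := by
  have := hμ.1
  exact (integral_prod _ (KK_int μ hμ κ a b c hκ0 hκ1 ha hb hc h)).symm

/-- Jensen for the three cyclic shifts of a point of the simplex. -/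
lemma JJ_jensen (μ : Measure (Fin 3 → ℝ)) (hμ : IsUniformSphereMeasure μ) (κ : ℝ)
    (hκ0 : 0 < κ) (hκ1 : κ ≤ 1) (p q r a b c : ℝ) (hp : 0 ≤ p) (hq : 0 ≤ q) (hr : 0 ≤ r)
    (hs : p + q + r = 1) (ha : 0 ≤ a) (hb : 0 ≤ b) (hc : 0 ≤ c) (h : a + b + c = 1) :
    JJ μ κ (p * a + q * b + r * c) (p * b + q * c + r * a) (p * c + q * a + r * b) ≤
      JJ μ κ a b c := by
  have i1 := KK_int μ hμ κ a b c hκ0 hκ1 ha hb hc h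
  have i2 := KK_int μ hμ κ b c a hκ0 hκ1 hb hc ha (by linarith)
  have i3 := KK_int μ hμ κ c a b hκ0 hκ1 hc ha hb (by linarith)
  have e1 := JJ_eq μ hμ κ a b c hκ0 hκ1 ha hb hc h
  have e2 := JJ_eq μ hμ κ b c a hκ0 hκ1 hb hc ha (by linarith)
  have e3 := JJ_eq μ hμ κ c a b hκ0 hκ1 hc ha hb (by linarith)
  have c1 := JJ_cyc μ hμ κ a b c
  have c2 := JJ_cyc μ hμ κ b c a
  have hsum : (p * a + q * b + r * c) + (p * b + q * c + r * a) + (p * c + q * a + r * b) = 1 := by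
    linear_combination (p + q + r) * h + hs
  have key : ∫ z, KK κ (p * a + q * b + r * c) (p * b + q * c + r * a) (p * c + q * a + r * b) z
      ∂(μ.prod μ) ≤ ∫ z, (p * KK κ a b c z + q * KK κ b c a z + r * KK κ c a b z) ∂(μ.prod μ) := by
    refine integral_mono_ae (KK_int μ hμ κ _ _ _ hκ0 hκ1 (by positivity) (by positivity)
      (by positivity) hsum) (((i1.const_mul p).add (i2.const_mul q)).add (i3.const_mul r)) ?_
    filter_upwards [ae_sph μ hμ] with z hz
    have := FF_jensen p q r _ _ _ hp hq hr hs
      (arg_mem κ a b c hκ0 hκ1 ha hb hc h _ _ hz.1 hz.2)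
      (arg_mem κ b c a hκ0 hκ1 hb hc ha (by linarith) _ _ hz.1 hz.2)
      (arg_mem κ c a b hκ0 hκ1 hc ha hb (by linarith) _ _ hz.1 hz.2)
    refine le_trans (le_of_eq ?_) this
    unfold KK
    congr 1; ring
  rw [← JJ_eq μ hμ κ _ _ _ hκ0 hκ1 (by positivity) (by positivity) (by positivity) hsum,
    integral_add (f := fun z => p * KK κ a b c z + q * KK κ b c a z)
      ((i1.const_mul p).add (i2.const_mul q)) (i3.const_mul r),
    integral_add (i1.const_mul p) (i2.const_mul q), integral_const_mul, integral_const_mul,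
    integral_const_mul, ← e1, ← e2, ← e3, ← c2, ← c1] at key
  calc _ ≤ _ := key
    _ = (p + q + r) * JJ μ κ a b c := by ring
    _ = _ := by rw [hs, one_mul]

/-- For `0 < κ ≤ 1` and any unit direction `ĉ`, the average mutual information is minimal
for the isotropic direction `(1,1,1)/√3` and maximal for the direction `(0,0,1)`. -/
theorem stmt4 (μ : Measure (Fin 3 → ℝ)) (hμ : IsUniformSphereMeasure μ)
    (κ : ℝ) (hκ0 : 0 < κ) (hκ1 : κ ≤ 1)
    (c : Fin 3 → ℝ) (hc : c 0 ^ 2 + c 1 ^ 2 + c 2 ^ 2 = 1) :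
    avgMI μ κ ![1 / Real.sqrt 3, 1 / Real.sqrt 3, 1 / Real.sqrt 3] ≤ avgMI μ κ c ∧
    avgMI μ κ c ≤ avgMI μ κ ![0, 0, 1] := by
  have h3 : (1 / Real.sqrt 3) ^ 2 = 1 / 3 := by
    rw [div_pow, Real.sq_sqrt (by norm_num)]; norm_num
  rw [avg_eq μ hμ, avg_eq μ hμ, avg_eq μ hμ]
  simp only [Matrix.cons_val]
  rw [h3]
  constructor
  · have := JJ_jensen μ hμ κ hκ0 hκ1 (1/3) (1/3) (1/3) _ _ _ (by norm_num) (by norm_num)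
      (by norm_num) (by norm_num) (sq_nonneg (c 0)) (sq_nonneg (c 1)) (sq_nonneg (c 2)) hc
    convert this using 1
    congr 1 <;> linarith
  · have := JJ_jensen μ hμ κ hκ0 hκ1 (c 2 ^ 2) (c 1 ^ 2) (c 0 ^ 2) 0 0 1 (sq_nonneg _)
      (sq_nonneg _) (sq_nonneg _) (by linarith) (by norm_num) (by norm_num) (by norm_num)
      (by norm_num)
    convert this using 1 <;> congr 1 <;> ring
end

section
/- Let μ be the uniform probability measure on the unit sphere S² ⊂ ℝ³ and let 0 < κ < 1. Then ∫_{S²} (1 − log₂(1 + κ·|n₃|)) dμ(n) = 1 − ((1+κ)·ln(1+κ) − κ)/(κ·ln 2), where n₃ is the third coordinate of n. -/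
open MeasureTheory Matrix

theorem aux_inv (μ : Measure (Fin 3 → ℝ)) (hμ : IsUniformSphereMeasure μ)
    (O : Matrix (Fin 3) (Fin 3) ℝ) (hO : O * Oᵀ = 1) (f : (Fin 3 → ℝ) → ℝ) (hf : Continuous f) :
    ∫ v, f (O *ᵥ v) ∂μ = ∫ v, f v ∂μ := by
  have hc : Continuous (fun v : Fin 3 → ℝ => O *ᵥ v) := by fun_prop
  conv_rhs => rw [← hμ.2.2 O hO]
  rw [integral_map hc.measurable.aemeasurable hf.aestronglyMeasurable]

theorem aux_ae (μ : Measure (Fin 3 → ℝ)) (hμ : IsUniformSphereMeasure μ) :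
    ∀ᵐ v ∂μ, v 0 ^ 2 + v 1 ^ 2 + v 2 ^ 2 = 1 := by
  rw [ae_iff]; exact hμ.2.1

theorem aux_int (μ : Measure (Fin 3 → ℝ)) (hμ : IsUniformSphereMeasure μ)
    (f : (Fin 3 → ℝ) → ℝ) (hf : Continuous f) : Integrable f μ := by
  have := hμ.1
  obtain ⟨C, hC⟩ := (isCompact_Icc (a := (fun _ => -1 : Fin 3 → ℝ)) (b := fun _ => 1)).exists_bound_of_continuousOn hf.continuousOn
  refine Integrable.of_bound hf.aestronglyMeasurable C ?_
  filter_upwards [aux_ae μ hμ] with v hv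
  apply hC
  constructor <;> intro i <;> fin_cases i <;> simp <;>
    nlinarith [sq_nonneg (v 0), sq_nonneg (v 1), sq_nonneg (v 2)]

theorem aux_swap (μ : Measure (Fin 3 → ℝ)) (hμ : IsUniformSphereMeasure μ) (m : ℕ) :
    ∫ v, v 0 ^ 2 * v 2 ^ m ∂μ = ∫ v, v 1 ^ 2 * v 2 ^ m ∂μ := by
  have h := aux_inv μ hμ !![0,1,0;1,0,0;0,0,1]
    (by ext i j; fin_cases i <;> fin_cases j <;> simp [Matrix.mul_apply, Fin.sum_univ_three])
    (fun v => v 1 ^ 2 * v 2 ^ m) (by fun_prop)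
  simpa [Matrix.mulVec, dotProduct, Fin.sum_univ_three] using h

theorem aux_rot (μ : Measure (Fin 3 → ℝ)) (hμ : IsUniformSphereMeasure μ) (m : ℕ) (t : ℝ) :
    ∫ v, (Real.cos t * v 1 - Real.sin t * v 2) * (Real.sin t * v 1 + Real.cos t * v 2) ^ (m+1) ∂μ
      = ∫ v, v 1 * v 2 ^ (m+1) ∂μ := by
  have h := aux_inv μ hμ !![1,0,0;0,Real.cos t,-Real.sin t;0,Real.sin t,Real.cos t]
    (by
      have := Real.sin_sq_add_cos_sq t
      ext i j; fin_cases i <;> fin_cases j <;> simp [Matrix.mul_apply, Fin.sum_univ_three] <;> linarith)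
    (fun v => v 1 * v 2 ^ (m+1)) (by fun_prop)
  simpa [Matrix.mulVec, dotProduct, Fin.sum_univ_three, sub_eq_add_neg] using h

theorem aux_deriv (μ : Measure (Fin 3 → ℝ)) (hμ : IsUniformSphereMeasure μ) (m : ℕ) :
    (m + 1) * ∫ v, v 1 ^ 2 * v 2 ^ m ∂μ = ∫ v, v 2 ^ (m+2) ∂μ := by
  have := hμ.1
  have key := hasDerivAt_integral_of_dominated_loc_of_deriv_le (μ := μ) (x₀ := (0:ℝ))
    (s := Set.univ) (bound := fun _ => (m:ℝ) + 2)
    (F := fun t v => (Real.cos t * v 1 - Real.sin t * v 2) *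
      (Real.sin t * v 1 + Real.cos t * v 2) ^ (m+1))
    (F' := fun t v => (-(Real.sin t * v 1 + Real.cos t * v 2)) *
      (Real.sin t * v 1 + Real.cos t * v 2) ^ (m+1) +
      (Real.cos t * v 1 - Real.sin t * v 2) * (((m+1:ℕ):ℝ) *
      (Real.sin t * v 1 + Real.cos t * v 2) ^ m * (Real.cos t * v 1 - Real.sin t * v 2)))
    Filter.univ_mem
    (Filter.Eventually.of_forall fun t => Continuous.aestronglyMeasurable (by fun_prop))
    (aux_int μ hμ _ (by fun_prop))
    (Continuous.aestronglyMeasurable (by fun_prop))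
    (by
      filter_upwards [aux_ae μ hμ] with v hv t _
      have hsc := Real.sin_sq_add_cos_sq t
      set Y := Real.cos t * v 1 - Real.sin t * v 2 with hY
      set Z := Real.sin t * v 1 + Real.cos t * v 2 with hZ
      have hYZ : Y ^ 2 + Z ^ 2 ≤ 1 := by
        have : Y ^ 2 + Z ^ 2 = (Real.sin t ^ 2 + Real.cos t ^ 2) * (v 1 ^ 2 + v 2 ^ 2) := by
          rw [hY, hZ]; ring
        rw [this, hsc]; nlinarith [sq_nonneg (v 0)]
      have hYa : |Y| ≤ 1 := by rw [abs_le]; constructor <;> nlinarith [sq_nonneg Z]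
      have hZa : |Z| ≤ 1 := by rw [abs_le]; constructor <;> nlinarith [sq_nonneg Y]
      have h1 : |Z| ^ (m+1) ≤ 1 := pow_le_one₀ (abs_nonneg _) hZa
      have h2 : |Z| ^ m ≤ 1 := pow_le_one₀ (abs_nonneg _) hZa
      rw [Real.norm_eq_abs]
      refine (abs_add_le _ _).trans ?_
      simp only [abs_mul, abs_neg, abs_pow, Nat.abs_cast]
      have e1 : |Z| * |Z| ^ (m+1) ≤ 1 := mul_le_one₀ hZa (by positivity) h1
      have e2 : |Y| * (((m+1:ℕ):ℝ) * |Z| ^ m * |Y|) ≤ m + 1 := by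
        have : |Y| * (((m+1:ℕ):ℝ) * |Z| ^ m * |Y|) = ((m:ℝ)+1) * (|Z| ^ m * (|Y| * |Y|)) := by
          push_cast; ring
        rw [this]
        have : |Z| ^ m * (|Y| * |Y|) ≤ 1 :=
          mul_le_one₀ h2 (by positivity) (mul_le_one₀ hYa (by positivity) hYa)
        have hm : (0:ℝ) ≤ m + 1 := by positivity
        nlinarith
      linarith)
    (integrable_const _)
    (by
      refine Filter.Eventually.of_forall fun v t _ => ?_
      have hY : HasDerivAt (fun t => Real.cos t * v 1 - Real.sin t * v 2)
          (-(Real.sin t * v 1 + Real.cos t * v 2)) t := by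
        refine HasDerivAt.congr_deriv (((Real.hasDerivAt_cos t).mul_const (v 1)).sub
          ((Real.hasDerivAt_sin t).mul_const (v 2))) ?_
        ring
      have hZ : HasDerivAt (fun t => Real.sin t * v 1 + Real.cos t * v 2)
          (Real.cos t * v 1 - Real.sin t * v 2) t := by
        refine HasDerivAt.congr_deriv (((Real.hasDerivAt_sin t).mul_const (v 1)).add
          ((Real.hasDerivAt_cos t).mul_const (v 2))) ?_
        ring
      exact hY.mul (hZ.pow (m+1)))
  have h2 := key.2
  simp only [aux_rot μ hμ m] at h2
  have h3 := h2.unique (hasDerivAt_const _ _)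
  simp only [Real.cos_zero, Real.sin_zero, one_mul, zero_mul, sub_zero, zero_add] at h3
  rw [integral_add (aux_int μ hμ _ (by fun_prop)) (aux_int μ hμ _ (by fun_prop))] at h3
  have e1 : ∫ v : Fin 3 → ℝ, -v 2 * v 2 ^ (m+1) ∂μ = - ∫ v, v 2 ^ (m+2) ∂μ := by
    rw [← integral_neg]; congr 1; ext v; ring
  have e2 : ∫ v : Fin 3 → ℝ, v 1 * (((m+1:ℕ):ℝ) * v 2 ^ m * v 1) ∂μ
      = (m+1) * ∫ v, v 1 ^ 2 * v 2 ^ m ∂μ := by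
    rw [← integral_const_mul]; congr 1; ext v; push_cast; ring
  rw [e1, e2] at h3
  linarith

theorem aux_rec (μ : Measure (Fin 3 → ℝ)) (hμ : IsUniformSphereMeasure μ) (m : ℕ) :
    ((m:ℝ) + 3) * ∫ v, v 2 ^ (m+2) ∂μ = (m + 1) * ∫ v, v 2 ^ m ∂μ := by
  have h1 := aux_deriv μ hμ m
  have h2 := aux_swap μ hμ m
  have h3 : ∫ v, v 2 ^ m ∂μ = ∫ v, v 0 ^ 2 * v 2 ^ m ∂μ + ∫ v, v 1 ^ 2 * v 2 ^ m ∂μ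
      + ∫ v, v 2 ^ (m+2) ∂μ := by
    rw [← integral_add (aux_int μ hμ _ (by fun_prop)) (aux_int μ hμ _ (by fun_prop)),
      ← integral_add (aux_int μ hμ _ (by fun_prop)) (aux_int μ hμ _ (by fun_prop))]
    apply integral_congr_ae
    filter_upwards [aux_ae μ hμ] with v hv
    calc v 2 ^ m = (v 0 ^ 2 + v 1 ^ 2 + v 2 ^ 2) * v 2 ^ m := by rw [hv, one_mul]
      _ = _ := by ring
  rw [h3, h2]
  linear_combination (-2) * h1

theorem aux_mom (μ : Measure (Fin 3 → ℝ)) (hμ : IsUniformSphereMeasure μ) (k : ℕ) :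
    ∫ v, (v 2 ^ 2) ^ k ∂μ = 1 / (2 * k + 1) := by
  have := hμ.1
  induction k with
  | zero => simp
  | succ k ih =>
    have h := aux_rec μ hμ (2*k)
    simp only [← pow_mul] at ih ⊢
    rw [ih] at h
    rw [show 2 * (k+1) = 2*k+2 by ring]
    push_cast at h ⊢
    have : (2 * (k:ℝ) + 3) ≠ 0 := by positivity
    have : (2 * (k:ℝ) + 1) ≠ 0 := by positivity
    field_simp at h ⊢
    linarith

theorem aux_poly (μ : Measure (Fin 3 → ℝ)) (hμ : IsUniformSphereMeasure μ) (p : Polynomial ℝ) :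
    ∫ v, p.eval (v 2 ^ 2) ∂μ = ∫ t in (0:ℝ)..1, p.eval (t ^ 2) := by
  induction p using Polynomial.induction_on' with
  | add p q hp hq =>
    simp only [Polynomial.eval_add]
    rw [integral_add (aux_int μ hμ _ (by fun_prop)) (aux_int μ hμ _ (by fun_prop)),
      intervalIntegral.integral_add (Continuous.intervalIntegrable (by fun_prop) _ _)
        (Continuous.intervalIntegrable (by fun_prop) _ _), hp, hq]
  | monomial n a =>
    simp only [Polynomial.eval_monomial]
    rw [integral_const_mul, intervalIntegral.integral_const_mul, aux_mom μ hμ]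
    simp only [← pow_mul, integral_pow]
    simp

theorem aux_main (μ : Measure (Fin 3 → ℝ)) (hμ : IsUniformSphereMeasure μ) (f : ℝ → ℝ)
    (hf : Continuous f) : ∫ v, f |v 2| ∂μ = ∫ t in (0:ℝ)..1, f t := by
  have := hμ.1
  apply eq_of_abs_sub_le_all
  intro ε hε
  obtain ⟨p, hp⟩ := exists_polynomial_near_of_continuousOn 0 1 (fun s => f (√s))
    (by fun_prop) (ε/2) (by positivity)
  have h1 : |∫ v, f |v 2| ∂μ - ∫ v, p.eval (v 2 ^ 2) ∂μ| ≤ ε/2 := by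
    rw [← integral_sub (aux_int μ hμ _ (by fun_prop)) (aux_int μ hμ _ (by fun_prop))]
    have := norm_integral_le_of_norm_le_const (μ := μ)
      (f := fun v => f |v 2| - p.eval (v 2 ^ 2)) (C := ε/2) (by
        filter_upwards [aux_ae μ hμ] with v hv
        have := hp (v 2 ^ 2) ⟨by positivity, by nlinarith [sq_nonneg (v 0), sq_nonneg (v 1)]⟩
        rw [Real.sqrt_sq_eq_abs, abs_sub_comm] at this
        exact this.le)
    simpa using this
  have h2 : |(∫ t in (0:ℝ)..1, f t) - ∫ t in (0:ℝ)..1, p.eval (t ^ 2)| ≤ ε/2 := by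
    rw [← intervalIntegral.integral_sub (Continuous.intervalIntegrable (by fun_prop) _ _)
        (Continuous.intervalIntegrable (by fun_prop) _ _)]
    have := intervalIntegral.norm_integral_le_of_norm_le_const (a := (0:ℝ)) (b := 1)
      (f := fun t => f t - p.eval (t ^ 2)) (C := ε/2) (by
        intro t ht
        rw [Set.uIoc_of_le zero_le_one] at ht
        have := hp (t ^ 2) ⟨by positivity, by nlinarith [ht.1, ht.2]⟩
        rw [Real.sqrt_sq ht.1.le, abs_sub_comm] at this
        exact this.le)
    simpa using this
  rw [aux_poly μ hμ] at h1
  rw [abs_le] at *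
  constructor <;> linarith [h1.1, h1.2, h2.1, h2.2]

theorem aux_log (κ : ℝ) (hκ0 : 0 < κ) :
    ∫ t in (0:ℝ)..1, Real.log (1 + κ * t) = ((1 + κ) * Real.log (1 + κ) - κ) / κ := by
  have := intervalIntegral.integral_comp_add_mul (a := 0) (b := 1) Real.log hκ0.ne' 1
  rw [this, integral_log]
  simp
  field_simp
  ring

/-- Average RSP figure of merit for the state `ρ⁰_2iso` with `E = κ·diag(0,0,1)`,
for `0 < κ < 1`:
`∫ (1 − log₂(1 + κ|n₃|)) dμ(n) = 1 − ((1+κ)ln(1+κ) − κ)/(κ ln 2)`. -/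
theorem stmt12 (μ : Measure (Fin 3 → ℝ)) (hμ : IsUniformSphereMeasure μ)
    (κ : ℝ) (hκ0 : 0 < κ) (hκ1 : κ < 1) :
    (∫ n, (1 - Real.logb 2 (1 + κ * |n 2|)) ∂μ) =
      1 - ((1 + κ) * Real.log (1 + κ) - κ) / (κ * Real.log 2) := by
  have := hμ.1
  have h := aux_main μ hμ (fun t => 1 - Real.logb 2 (1 + κ * |t|)) (by
    unfold Real.logb
    refine continuous_const.sub (Continuous.div_const (Continuous.log (by fun_prop) ?_) _)
    intro t
    positivity)
  simp only [abs_abs] at h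
  rw [h]
  have e : ∫ t in (0:ℝ)..1, (1 - Real.logb 2 (1 + κ * |t|))
      = ∫ t in (0:ℝ)..1, (1 - Real.log (1 + κ * t) / Real.log 2) := by
    apply intervalIntegral.integral_congr
    intro t ht
    rw [Set.uIcc_of_le zero_le_one] at ht
    simp only [Real.logb, abs_of_nonneg ht.1]
  rw [e, intervalIntegral.integral_sub (by simp), intervalIntegral.integral_div, aux_log κ hκ0]
  · simp [div_div]
  · apply ContinuousOn.intervalIntegrable
    refine ContinuousOn.div_const (ContinuousOn.log (by fun_prop) ?_) _
    intro t ht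
    rw [Set.uIcc_of_le zero_le_one] at ht
    have := mul_nonneg hκ0.le ht.1
    linarith
end
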